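/- For all integers x and y, the equation 70x² + 4xy − 2y² = −2 holds if and only if x = 0 and (y = 1 or y = −1). In other words, up to sign the lattice R contains a unique vector of square −2. -/

import Mathlib

/-- For all integers `x` and `y`, `70x² + 4xy − 2y² = −2` holds iff `x = 0` and
`y = 1` or `y = −1`: up to sign the lattice `R` contains a unique vector of square `−2`. -/
theorem stmt_0 (x y : ℤ) :
    70 * x ^ 2 + 4 * x * y - 2 * y ^ 2 = -2 ↔ x = 0 ∧ (y = 1 ∨ y = -1) := by
  constructor
  · intro h
    have hfactor : (y - 7 * x) * (y + 5 * x) = 1 := by linarith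
    rcases Int.mul_eq_one_iff_eq_one_or_neg_one.mp hfactor with ⟨h₁, h₂⟩ | ⟨h₁, h₂⟩ <;> omega
  · rintro ⟨rfl, rfl | rfl⟩ <;> norm_num
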